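/- arXiv:1802.07186 — 4 statements merged into one kernel-verified Lean document; each statement's English description precedes it below -/
import Mathlib

section
/- Moser-type product estimate: for all integers n ≥ 1 and s ≥ 1 there exists a constant c_s > 0 with the following property. If u, v : ℝⁿ → ℝ are s-times continuously differentiable and all partial derivatives of u and of v of order at most s are bounded and square-integrable on ℝⁿ, then for every multi-index α with |α| ≤ s one has ‖∂^α(u v)‖_{L²(ℝⁿ)} ≤ c_s ( ‖u‖_{L^∞} ‖v‖_{W^{s,2}} + ‖v‖_{L^∞} ‖u‖_{W^{s,2}} ). -/
open MeasureTheory Finset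

/-- Partial derivative in the `i`-th coordinate direction. -/
noncomputable def pd {n : ℕ} (i : Fin n) (f : (Fin n → ℝ) → ℝ) : (Fin n → ℝ) → ℝ :=
  fun x => fderiv ℝ f x (Pi.single i 1)

/-- Classical partial derivative `∂^α` for a multi-index `α`. -/
noncomputable def mderiv {n : ℕ} (α : Fin n → ℕ) (f : (Fin n → ℝ) → ℝ) : (Fin n → ℝ) → ℝ :=
  (List.ofFn fun i : Fin n => (pd i)^[α i]).foldr (· ∘ ·) id f

/-- The finite set of multi-indices `α` with `|α| ≤ s`. -/
def multiIndices (n s : ℕ) : Finset (Fin n → ℕ) :=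
  (Fintype.piFinset fun _ : Fin n => Finset.range (s + 1)).filter fun α => ∑ i, α i ≤ s

/-- The `L²(ℝⁿ)` norm. -/
noncomputable def L2norm {n : ℕ} (f : (Fin n → ℝ) → ℝ) : ℝ :=
  Real.sqrt (∫ x, f x ^ 2)

/-- The `L^∞(ℝⁿ)` norm (for bounded functions). -/
noncomputable def LinfNorm {n : ℕ} (f : (Fin n → ℝ) → ℝ) : ℝ :=
  ⨆ x, |f x|

/-- The Sobolev norm `‖f‖_{W^{s,2}}`. -/
noncomputable def sobNorm (n s : ℕ) (f : (Fin n → ℝ) → ℝ) : ℝ :=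
  Real.sqrt (∑ α ∈ multiIndices n s, ∫ x, mderiv α f x ^ 2)


/-- Iterated partial derivative along a word. -/
noncomputable def wd {n : ℕ} (L : List (Fin n)) (f : (Fin n → ℝ) → ℝ) : (Fin n → ℝ) → ℝ :=
  L.foldr pd f

lemma wd_nil {n : ℕ} (f : (Fin n → ℝ) → ℝ) : wd [] f = f := rfl

lemma wd_cons {n : ℕ} (i : Fin n) (L : List (Fin n)) (f : (Fin n → ℝ) → ℝ) :
    wd (i :: L) f = pd i (wd L f) := rfl

lemma wd_append {n : ℕ} (L M : List (Fin n)) (f : (Fin n → ℝ) → ℝ) :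
    wd (L ++ M) f = wd L (wd M f) := by
  simp [wd, List.foldr_append]

lemma wd_replicate {n : ℕ} (i : Fin n) (k : ℕ) (f : (Fin n → ℝ) → ℝ) :
    wd (List.replicate k i) f = (pd i)^[k] f := by
  induction k with
  | zero => rfl
  | succ k ih => rw [List.replicate_succ, wd_cons, ih, Function.iterate_succ_apply']

lemma pd_contDiff {n : ℕ} (i : Fin n) (m : ℕ) (f : (Fin n → ℝ) → ℝ)
    (hf : ContDiff ℝ ((m + 1 : ℕ)) f) : ContDiff ℝ m (pd i f) := by
  unfold pd
  have := hf.fderiv_right (m := m) (by norm_cast)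
  exact this.clm_apply contDiff_const

lemma wd_contDiff {n : ℕ} (L : List (Fin n)) : ∀ (m : ℕ) (f : (Fin n → ℝ) → ℝ),
    ContDiff ℝ ((m + L.length : ℕ)) f → ContDiff ℝ m (wd L f) := by
  induction L with
  | nil => intro m f hf; simpa [wd_nil] using hf
  | cons i L ih =>
    intro m f hf
    rw [wd_cons]
    apply pd_contDiff
    apply ih
    convert hf using 2
    simp; ring

lemma wd_contDiff' {n : ℕ} (L : List (Fin n)) (m s : ℕ) (f : (Fin n → ℝ) → ℝ)
    (h : m + L.length ≤ s) (hf : ContDiff ℝ s f) : ContDiff ℝ m (wd L f) :=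
  wd_contDiff L m f (hf.of_le (by exact_mod_cast h))

lemma pd_comm {n : ℕ} (i j : Fin n) (f : (Fin n → ℝ) → ℝ) (hf : ContDiff ℝ 2 f) :
    pd i (pd j f) = pd j (pd i f) := by
  have hd : Differentiable ℝ (fderiv ℝ f) :=
    (hf.fderiv_right (m := 1) (by norm_num)).differentiable (by norm_num)
  have key : ∀ (a b : Fin n) x, pd a (pd b f) x
      = fderiv ℝ (fderiv ℝ f) x (Pi.single a 1) (Pi.single b 1) := by
    intro a b x
    unfold pd
    rw [fderiv_clm_apply (hd x) (by fun_prop)]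
    simp
  funext x
  rw [key, key]
  exact (hf.contDiffAt.isSymmSndFDerivAt (by simp)).eq _ _

lemma wd_perm {n : ℕ} {L M : List (Fin n)} (h : L.Perm M) : ∀ (f : (Fin n → ℝ) → ℝ),
    ContDiff ℝ (L.length : ℕ) f → wd L f = wd M f := by
  induction h with
  | nil => intros; rfl
  | cons a h ih =>
    intro f hf
    rw [wd_cons, wd_cons, ih f (hf.of_le (by simp))]
  | swap a b l =>
    intro f hf
    simp only [wd_cons]
    apply pd_comm
    exact wd_contDiff' l 2 _ f (by simp; omega) hf
  | trans h1 h2 ih1 ih2 =>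
    intro f hf
    rw [ih1 f hf, ih2 f (by rwa [← h1.length_eq])]

/-- Canonical word of a multi-index. -/
def canon {n : ℕ} (α : Fin n → ℕ) : List (Fin n) :=
  (List.ofFn fun i : Fin n => List.replicate (α i) i).flatten

lemma mderiv_eq_wd {n : ℕ} (α : Fin n → ℕ) (f : (Fin n → ℝ) → ℝ) :
    mderiv α f = wd (canon α) f := by
  unfold mderiv canon
  rw [List.ofFn_eq_map, List.ofFn_eq_map]
  generalize List.finRange n = l
  induction l with
  | nil => rfl
  | cons a l ih =>
    simp only [List.map_cons, List.foldr_cons, List.flatten_cons, Function.comp_apply,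
      wd_append, wd_replicate]
    rw [ih]

lemma canon_length {n : ℕ} (α : Fin n → ℕ) : (canon α).length = ∑ i, α i := by
  simp [canon, List.length_flatten, List.map_ofFn, List.sum_ofFn]

lemma canon_count {n : ℕ} (α : Fin n → ℕ) (i : Fin n) : (canon α).count i = α i := by
  simp [canon, List.count_flatten, List.map_ofFn, List.sum_ofFn, List.count_replicate]

lemma wd_eq_mderiv {n : ℕ} (L : List (Fin n)) (f : (Fin n → ℝ) → ℝ)
    (hf : ContDiff ℝ (L.length : ℕ) f) : wd L f = mderiv (fun i => L.count i) f := by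
  rw [mderiv_eq_wd]
  apply wd_perm _ f hf
  rw [List.perm_iff_count]
  intro a
  rw [canon_count]

lemma count_mem {n s : ℕ} (L : List (Fin n)) (h : L.length ≤ s) :
    (fun i => L.count i) ∈ multiIndices n s := by
  unfold multiIndices
  rw [Finset.mem_filter, Fintype.mem_piFinset]
  refine ⟨fun i => ?_, ?_⟩
  · rw [Finset.mem_range]
    have := List.count_le_length (a := i) (l := L)
    omega
  · have : ∑ i, L.count i = L.length := by
      simpa using (Multiset.sum_count_eq_card (s := Finset.univ) (m := (L : Multiset (Fin n))) (by simp))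
    exact this.trans_le h

lemma pd_smul {n : ℕ} (i : Fin n) (c : ℝ) (f : (Fin n → ℝ) → ℝ) :
    pd i (fun x => c * f x) = fun x => c * pd i f x := by
  funext x
  unfold pd
  have : (fun x => c * f x) = c • f := rfl
  rw [this, fderiv_const_smul_field]
  simp

lemma wd_smul {n : ℕ} (L : List (Fin n)) (c : ℝ) (f : (Fin n → ℝ) → ℝ) :
    wd L (fun x => c * f x) = fun x => c * wd L f x := by
  induction L with
  | nil => rfl
  | cons i L ih => rw [wd_cons, ih, pd_smul, wd_cons]

lemma wd_add {n : ℕ} (L : List (Fin n)) (f g : (Fin n → ℝ) → ℝ)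
    (hf : ContDiff ℝ (L.length : ℕ) f) (hg : ContDiff ℝ (L.length : ℕ) g) :
    wd L (fun x => f x + g x) = fun x => wd L f x + wd L g x := by
  induction L with
  | nil => rfl
  | cons i L ih =>
    rw [wd_cons, ih (hf.of_le (by simp)) (hg.of_le (by simp))]
    have h1 := wd_contDiff' L 1 _ f (by simp [add_comm]) hf
    have h2 := wd_contDiff' L 1 _ g (by simp [add_comm]) hg
    funext x
    simp only [wd_cons]
    unfold pd
    rw [fderiv_fun_add (h1.differentiable (by norm_num) x) (h2.differentiable (by norm_num) x)]
    simp

lemma leib {n : ℕ} (k : ℕ) (u v : (Fin n → ℝ) → ℝ) (hu : ContDiff ℝ k u) (hv : ContDiff ℝ k v)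
    (x : Fin n → ℝ) (M : ℝ)
    (hM : ∀ P Q : List (Fin n), P.length + Q.length = k → |wd P u x * wd Q v x| ≤ M)
    (L : List (Fin n)) : ∀ P Q : List (Fin n), L.length + P.length + Q.length = k →
      |wd L (fun y => wd P u y * wd Q v y) x| ≤ 2 ^ L.length * M := by
  induction L using List.reverseRecOn with
  | nil =>
    intro P Q h
    simpa [wd_nil] using hM P Q (by simpa using h)
  | append_singleton L i ih =>
    intro P Q h
    simp only [List.length_append, List.length_cons, List.length_nil] at h
    rw [wd_append, wd_cons, wd_nil]
    have e : pd i (fun y => wd P u y * wd Q v y)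
        = fun y => wd (i :: P) u y * wd Q v y + wd P u y * wd (i :: Q) v y := by
      have h1 := wd_contDiff' P 1 k u (by omega) hu
      have h2 := wd_contDiff' Q 1 k v (by omega) hv
      funext y
      simp only [wd_cons]
      unfold pd
      rw [fderiv_fun_mul (h1.differentiable (by norm_num) y) (h2.differentiable (by norm_num) y)]
      simp
      ring
    have c1 := wd_contDiff' (i :: P) L.length k u (by simp; omega) hu
    have c2 := wd_contDiff' Q L.length k v (by omega) hv
    have c3 := wd_contDiff' P L.length k u (by omega) hu
    have c4 := wd_contDiff' (i :: Q) L.length k v (by simp; omega) hv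
    rw [e, wd_add L _ _ (c1.mul c2) (c3.mul c4)]
    have i1 := ih (i :: P) Q (by simp; omega)
    have i2 := ih P (i :: Q) (by simp; omega)
    have := abs_add_le (wd L (fun y => wd (i :: P) u y * wd Q v y) x)
      (wd L (fun y => wd P u y * wd (i :: Q) v y) x)
    simp only [List.length_append, List.length_cons, List.length_nil, pow_succ, zero_add]
    linarith


lemma young3 (w1 w2 w3 : ℝ) (h1 : 0 ≤ w1) (h2 : 0 < w2) (h3 : 0 ≤ w3) (hw : w1 + w2 + w3 = 1)
    (ε : ℝ) (hε : 0 < ε) : ∃ C : ℝ, 0 ≤ C ∧ ∀ x y z : ℝ, 0 ≤ x → 0 ≤ y → 0 ≤ z →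
      x ^ w1 * y ^ w2 * z ^ w3 ≤ ε * x + C * y + ε * z := by
  refine ⟨ε ^ (-(w1 + w3) / w2), by positivity, ?_⟩
  intro x y z hx hy hz
  set C := ε ^ (-(w1 + w3) / w2) with hC
  have hC0 : 0 < C := by positivity
  have := Real.geom_mean_le_arith_mean3_weighted h1 h2.le h3 (p₁ := ε * x) (p₂ := C * y)
    (p₃ := ε * z) (by positivity) (by positivity) (by positivity) hw
  rw [Real.mul_rpow hε.le hx, Real.mul_rpow hC0.le hy, Real.mul_rpow hε.le hz] at this
  have hCw : ε ^ w1 * C ^ w2 * ε ^ w3 = 1 := by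
    rw [hC, ← Real.rpow_mul hε.le, ← Real.rpow_add hε, ← Real.rpow_add hε]
    have : w1 + -(w1 + w3) / w2 * w2 + w3 = 0 := by field_simp; ring
    rw [this, Real.rpow_zero]
  have e : ε ^ w1 * x ^ w1 * (C ^ w2 * y ^ w2) * (ε ^ w3 * z ^ w3)
      = x ^ w1 * y ^ w2 * z ^ w3 := by
    calc _ = (ε ^ w1 * C ^ w2 * ε ^ w3) * (x ^ w1 * y ^ w2 * z ^ w3) := by ring
      _ = _ := by rw [hCw, one_mul]
  rw [e] at this
  have a1 : w1 * (ε * x) ≤ 1 * (ε * x) := by gcongr; linarith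
  have a2 : w2 * (C * y) ≤ 1 * (C * y) := by gcongr; linarith
  have a3 : w3 * (ε * z) ≤ 1 * (ε * z) := by gcongr; linarith
  linarith

lemma hasDerivAt_phi (q : ℝ) (hq : 0 < q) (t : ℝ) :
    HasDerivAt (fun t : ℝ => |t| ^ q * t) ((q + 1) * |t| ^ q) t := by
  rcases eq_or_ne t 0 with rfl | ht
  · rw [hasDerivAt_iff_tendsto_slope]
    have h : Filter.Tendsto (fun t : ℝ => |t| ^ q) (nhds 0) (nhds ((q + 1) * |(0 : ℝ)| ^ q)) := by
      have hc : Continuous (fun t : ℝ => |t| ^ q) :=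
        continuous_abs.rpow_const (fun _ => Or.inr hq.le)
      have := hc.tendsto 0
      simpa [Real.zero_rpow hq.ne'] using this
    refine (h.mono_left nhdsWithin_le_nhds).congr' ?_
    filter_upwards [self_mem_nhdsWithin] with y hy
    have hy : y ≠ 0 := hy
    simp [slope_def_field, hy]
  · have h1 : HasDerivAt (fun t : ℝ => |t| ^ q) (SignType.sign t * q * |t| ^ (q - 1)) t :=
      (hasDerivAt_abs ht).rpow_const (Or.inl (abs_ne_zero.mpr ht))
    have h2 := h1.fun_mul (hasDerivAt_id' t)
    have h3 : (SignType.sign t : ℝ) * t = |t| := by rw [mul_comm]; exact self_mul_sign t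
    have h4 : |t| ^ q = |t| ^ (q - 1) * |t| := by
      rw [← Real.rpow_add_one (abs_ne_zero.mpr ht)]; simp
    have h5 : (SignType.sign t : ℝ) * q * |t| ^ (q - 1) * t + |t| ^ q * 1 = (q + 1) * |t| ^ q := by
      rw [h4, ← h3]; ring
    rwa [h5] at h2

lemma integrable_mul_bdd {n : ℕ} (f g w : (Fin n → ℝ) → ℝ) (hf : Continuous f)
    (hg : Continuous g) (hw : Continuous w) (hf2 : Integrable fun x => f x ^ 2)
    (hg2 : Integrable fun x => g x ^ 2) (B : ℝ) (hB : ∀ x, |w x| ≤ B) :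
    Integrable fun x => w x * (f x * g x) := by
  refine ((hf2.add hg2).const_mul B).mono' (by fun_prop) (Filter.Eventually.of_forall fun x => ?_)
  simp only [Real.norm_eq_abs, Pi.add_apply]
  rw [abs_mul]
  have h0 : 0 ≤ B := (abs_nonneg _).trans (hB x)
  have : |f x * g x| ≤ f x ^ 2 + g x ^ 2 := by
    rw [abs_le]; constructor <;> nlinarith [sq_nonneg (f x + g x), sq_nonneg (f x - g x)]
  exact mul_le_mul (hB x) this (abs_nonneg _) h0

lemma integrable_rpow {n : ℕ} (f : (Fin n → ℝ) → ℝ) (hf : Continuous f)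
    (hf2 : Integrable fun x => f x ^ 2) (B : ℝ) (hB : ∀ x, |f x| ≤ B) (p : ℝ) (hp : 2 ≤ p) :
    Integrable fun x => |f x| ^ p := by
  have h := integrable_mul_bdd f f (fun x => |f x| ^ (p - 2)) hf hf
    (hf.abs.rpow_const (fun _ => Or.inr (by linarith))) hf2 hf2 (B ^ (p - 2)) (fun x => by
      rw [abs_of_nonneg (by positivity)]
      exact Real.rpow_le_rpow (abs_nonneg _) (hB x) (by linarith))
  convert h using 2 with x
  rw [← abs_mul_abs_self (f x)]
  rcases eq_or_ne (|f x|) 0 with h0 | h0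
  · rw [h0, Real.zero_rpow (by linarith)]; simp
  · have : 0 < |f x| := lt_of_le_of_ne (abs_nonneg _) h0.symm
    rw [Real.rpow_sub this]
    field_simp
    rw [show (2 : ℝ) = ((2 : ℕ) : ℝ) by norm_num, Real.rpow_natCast]

lemma abs_rpow_split (t q : ℝ) (hq : 0 < q) : |t| ^ q * t * t = |t| ^ (q + 2) := by
  rw [Real.rpow_add_of_nonneg (abs_nonneg _) hq.le (by norm_num), mul_assoc,
    show (2 : ℝ) = ((2 : ℕ) : ℝ) by norm_num, Real.rpow_natCast, sq_abs, sq]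

lemma ibp {n : ℕ} (i : Fin n) (g : (Fin n → ℝ) → ℝ) (hg : ContDiff ℝ 2 g)
    (g2 : Integrable fun x => g x ^ 2) (h2 : Integrable fun x => pd i g x ^ 2)
    (l2 : Integrable fun x => pd i (pd i g) x ^ 2)
    (B : ℝ) (hB : ∀ x, |pd i g x| ≤ B) (q : ℝ) (hq : 0 < q) :
    Integrable (fun x => |g x| * |pd i (pd i g) x| * |pd i g x| ^ q) ∧
    ∫ x, |pd i g x| ^ (q + 2) ≤
      (q + 1) * ∫ x, |g x| * |pd i (pd i g) x| * |pd i g x| ^ q := by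
  have hh : ContDiff ℝ 1 (pd i g) := pd_contDiff i 1 g (by exact_mod_cast hg)
  have hl : Continuous (pd i (pd i g)) :=
    (pd_contDiff i 0 (pd i g) (by exact_mod_cast hh)).continuous
  have hgd : Differentiable ℝ g := hg.differentiable (by norm_num)
  have hhd : Differentiable ℝ (pd i g) := hh.differentiable (by norm_num)
  have hgc := hg.continuous
  have hhc := hh.continuous
  have hqc : Continuous fun x => |pd i g x| ^ q := hhc.abs.rpow_const (fun _ => Or.inr hq.le)
  have hqB : ∀ x, |(|pd i g x| ^ q)| ≤ B ^ q := fun x => by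
    rw [abs_of_nonneg (by positivity)]
    exact Real.rpow_le_rpow (abs_nonneg _) (hB x) hq.le
  have hφ : ∀ x, HasFDerivAt (fun x => |pd i g x| ^ q * pd i g x)
      (((q + 1) * |pd i g x| ^ q) • fderiv ℝ (pd i g) x) x := fun x =>
    (hasDerivAt_phi q hq (pd i g x)).comp_hasFDerivAt x (hhd x).hasFDerivAt
  have hφd : ∀ x, fderiv ℝ (fun x => |pd i g x| ^ q * pd i g x) x (Pi.single i 1) * g x
      = (q + 1) * (|pd i g x| ^ q * (pd i (pd i g) x * g x)) := fun x => by
    rw [(hφ x).fderiv]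
    have : fderiv ℝ (pd i g) x (Pi.single i 1) = pd i (pd i g) x := rfl
    simp only [_root_.smul_apply, smul_eq_mul, this]
    ring
  have I1 := integrable_mul_bdd _ _ _ hl hgc hqc l2 g2 _ hqB
  have I2 := integrable_mul_bdd _ _ _ hhc hhc hqc h2 h2 _ hqB
  have I3 := integrable_mul_bdd _ _ _ hhc hgc hqc h2 g2 _ hqB
  have key := integral_mul_fderiv_eq_neg_fderiv_mul_of_integrable (μ := volume)
    (f := fun x => |pd i g x| ^ q * pd i g x) (g := g) (v := Pi.single i 1)
    (by simp_rw [hφd]; exact I1.const_mul _)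
    (by simpa only [mul_assoc, pd] using I2)
    (by simpa only [mul_assoc] using I3)
    (fun x _ => (hφ x).differentiableAt) (fun x _ => hgd x)
  have eabs : ∀ x, |g x| * |pd i (pd i g) x| * |pd i g x| ^ q
      = ‖|pd i g x| ^ q * (pd i (pd i g) x * g x)‖ := fun x => by
    rw [Real.norm_eq_abs, abs_mul, abs_mul, abs_of_nonneg (by positivity : 0 ≤ |pd i g x| ^ q)]
    ring
  simp_rw [eabs]
  refine ⟨I1.norm, ?_⟩
  simp_rw [hφd] at key
  have e1 : ∫ x, |pd i g x| ^ (q + 2)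
      = ∫ x, |pd i g x| ^ q * pd i g x * fderiv ℝ g x (Pi.single i 1) := by
    congr 1; funext x
    exact (abs_rpow_split _ _ hq).symm
  rw [e1, key, integral_const_mul, ← mul_neg]
  gcongr
  refine (neg_le_abs _).trans ?_
  rw [← Real.norm_eq_abs]
  exact norm_integral_le_integral_norm _


/-- Regularity class: all word derivatives up to order `k` bounded and square integrable. -/
structure Good (n k : ℕ) (u : (Fin n → ℝ) → ℝ) : Prop where
  cd : ContDiff ℝ k u
  bd : ∀ L : List (Fin n), L.length ≤ k → ∃ C, ∀ x, |wd L u x| ≤ C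
  sq : ∀ L : List (Fin n), L.length ≤ k → Integrable fun x => wd L u x ^ 2

/-- The power function used at level `m`. -/
noncomputable def FF (k m : ℕ) (t : ℝ) : ℝ := if m = 0 then 0 else |t| ^ ((2 * k : ℝ) / m)

lemma FF_nonneg (k m : ℕ) (t : ℝ) : 0 ≤ FF k m t := by
  unfold FF; split_ifs <;> positivity

lemma FF_self (k : ℕ) (hk : 0 < k) (t : ℝ) : FF k k t = t ^ 2 := by
  unfold FF
  rw [if_neg hk.ne']
  have : (2 * k : ℝ) / k = ((2 : ℕ) : ℝ) := by
    have : (k : ℝ) ≠ 0 := by positivity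
    field_simp
    norm_num
  rw [this, Real.rpow_natCast, sq_abs]

lemma FF_root (k m : ℕ) (hk : 0 < k) (t : ℝ) (h : m = 0 → |t| ≤ 1) :
    |t| ≤ FF k m t ^ ((m : ℝ) / (2 * k)) := by
  unfold FF
  split_ifs with hm
  · subst hm
    simpa using h rfl
  · rw [← Real.rpow_mul (abs_nonneg _)]
    have : (2 * k : ℝ) / m * (m / (2 * k)) = 1 := by
      have : (k : ℝ) ≠ 0 := by positivity
      have : (m : ℝ) ≠ 0 := by positivity
      field_simp
    rw [this, Real.rpow_one]

lemma Good.FF_int {n k : ℕ} {u : (Fin n → ℝ) → ℝ} (hu : Good n k u) (L : List (Fin n)) (m : ℕ)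
    (hL : L.length ≤ k) (hm : m ≤ k) : Integrable fun x => FF k m (wd L u x) := by
  unfold FF
  split_ifs with h
  · exact integrable_zero _ _ _
  · obtain ⟨B, hB⟩ := hu.bd L hL
    refine integrable_rpow _ (wd_contDiff' L 0 k u (by omega) hu.cd).continuous (hu.sq L hL) B hB _ ?_
    have : (0 : ℝ) < m := by positivity
    rw [le_div_iff₀ this]
    have : (m : ℝ) ≤ k := by exact_mod_cast hm
    linarith

lemma step_word {n : ℕ} (k m : ℕ) (hm : m + 1 < k) (ε : ℝ) (hε : 0 < ε) :
    ∃ C : ℝ, 0 ≤ C ∧ ∀ u : (Fin n → ℝ) → ℝ, Good n k u → (∀ x, |u x| ≤ 1) →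
      ∀ (i : Fin n) (L : List (Fin n)), L.length = m →
        ∫ x, FF k (m + 1) (wd (i :: L) u x) ≤
          ε * (∫ x, FF k m (wd L u x)) + C * (∫ x, FF k (m + 2) (wd (i :: i :: L) u x))
            + ε * (∫ x, FF k (m + 1) (wd (i :: L) u x)) := by
  have hk : 0 < k := by omega
  have hkR : (0 : ℝ) < k := by exact_mod_cast hk
  have hmk : (m : ℝ) + 1 < k := by exact_mod_cast hm
  have hm1 : (0 : ℝ) < m + 1 := by positivity
  set q : ℝ := 2 * k / (m + 1) - 2 with hq
  have hq0 : 0 < q := by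
    rw [hq, sub_pos, lt_div_iff₀ hm1]; linarith
  obtain ⟨C, hC, hY⟩ := young3 (m / (2 * k)) ((m + 2) / (2 * k)) ((k - (m + 1)) / k)
    (by positivity) (by positivity) (div_nonneg (by linarith) hkR.le) (by field_simp; ring)
    (ε / (q + 1)) (by positivity)
  refine ⟨(q + 1) * C, by positivity, ?_⟩
  intro u hu hu1 i L hL
  have hg := wd_contDiff' L 2 k u (by omega) hu.cd
  obtain ⟨B, hB⟩ := hu.bd (i :: L) (by simp; omega)
  obtain ⟨J1, J2⟩ := ibp i (wd L u) hg (hu.sq L (by omega)) (hu.sq (i :: L) (by simp; omega))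
    (hu.sq (i :: i :: L) (by simp; omega)) B hB q hq0
  simp only [← wd_cons] at J1 J2
  have hFz : ∀ t, FF k (m + 1) t = |t| ^ (q + 2) := fun t => by
    unfold FF; rw [if_neg (by omega), hq]; push_cast; ring_nf
  have pw : ∀ x, |wd L u x| * |wd (i :: i :: L) u x| * |wd (i :: L) u x| ^ q ≤
      ε / (q + 1) * FF k m (wd L u x) + C * FF k (m + 2) (wd (i :: i :: L) u x)
        + ε / (q + 1) * FF k (m + 1) (wd (i :: L) u x) := by
    intro x
    refine le_trans ?_ (hY _ _ _ (FF_nonneg _ _ _) (FF_nonneg _ _ _) (FF_nonneg _ _ _))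
    have a1 := FF_root k m hk (wd L u x) (by
      intro h0
      have : L = [] := List.length_eq_zero_iff.mp (by omega)
      subst this
      exact hu1 x)
    have a2 := FF_root k (m + 2) hk (wd (i :: i :: L) u x) (by omega)
    have a3 : |wd (i :: L) u x| ^ q = FF k (m + 1) (wd (i :: L) u x) ^ (((k : ℝ) - (m + 1)) / k) := by
      rw [hFz, ← Real.rpow_mul (abs_nonneg _)]
      congr 1
      rw [hq]; field_simp; ring
    push_cast at a2
    rw [a3]
    have := FF_nonneg k (m + 1) (wd (i :: L) u x)
    have := FF_nonneg k m (wd L u x)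
    gcongr
  have i1 := hu.FF_int L m (by omega) (by omega)
  have i2 := hu.FF_int (i :: i :: L) (m + 2) (by simp; omega) (by omega)
  have i3 := hu.FF_int (i :: L) (m + 1) (by simp; omega) (by omega)
  have mono := integral_mono J1
    (((i1.const_mul (ε / (q + 1))).add (i2.const_mul C)).add (i3.const_mul (ε / (q + 1)))) pw
  rw [integral_add' ((i1.const_mul _).add (i2.const_mul _)) (i3.const_mul _),
    integral_add' (i1.const_mul _) (i2.const_mul _), integral_const_mul, integral_const_mul,
    integral_const_mul] at mono
  have e1 : ∫ x, FF k (m + 1) (wd (i :: L) u x) = ∫ x, |wd (i :: L) u x| ^ (q + 2) := by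
    simp_rw [hFz]
  calc _ = ∫ x, |wd (i :: L) u x| ^ (q + 2) := e1
    _ ≤ _ := J2
    _ ≤ _ := mul_le_mul_of_nonneg_left mono (by positivity)
    _ = _ := by field_simp

/-- Total energy at level `m`. -/
noncomputable def En {n : ℕ} (k m : ℕ) (u : (Fin n → ℝ) → ℝ) : ℝ :=
  ∑ w : Fin m → Fin n, ∫ x, FF k m (wd (List.ofFn w) u x)

lemma En_nonneg {n : ℕ} (k m : ℕ) (u : (Fin n → ℝ) → ℝ) : 0 ≤ En k m u :=
  Finset.sum_nonneg fun _ _ => integral_nonneg fun _ => FF_nonneg _ _ _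

lemma le_En {n : ℕ} (k m : ℕ) (u : (Fin n → ℝ) → ℝ) (L : List (Fin n)) (hL : L.length = m) :
    ∫ x, FF k m (wd L u x) ≤ En k m u := by
  subst hL
  have := Finset.single_le_sum (f := fun w : Fin L.length → Fin n =>
    ∫ x, FF k L.length (wd (List.ofFn w) u x))
    (fun _ _ => integral_nonneg fun _ => FF_nonneg _ _ _) (Finset.mem_univ L.get)
  simp only [List.ofFn_get] at this
  exact this

lemma En_le {n : ℕ} (k m : ℕ) (u : (Fin n → ℝ) → ℝ) (B : ℝ)
    (h : ∀ L : List (Fin n), L.length = m → ∫ x, FF k m (wd L u x) ≤ B) :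
    En k m u ≤ (n : ℝ) ^ m * B := by
  unfold En
  refine (Finset.sum_le_card_nsmul _ _ B fun w _ => h _ (by simp)).trans ?_
  simp

lemma chain {n : ℕ} (hn : 1 ≤ n) (k m : ℕ) (hm : m < k) :
    ∃ C : ℝ, 0 ≤ C ∧ ∀ u : (Fin n → ℝ) → ℝ, Good n k u → (∀ x, |u x| ≤ 1) →
      En k m u ≤ C * En k (m + 1) u := by
  induction m with
  | zero => exact ⟨0, le_rfl, fun u _ _ => by simp [En, FF]⟩
  | succ m ih =>
    obtain ⟨C0, hC0, h0⟩ := ih (by omega)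
    set N : ℝ := (n : ℝ) ^ (m + 1) with hN
    have hN0 : 0 < N := by positivity
    obtain ⟨C, hC, h⟩ := step_word (n := n) k m hm (1 / (2 * N * (C0 + 1))) (by positivity)
    refine ⟨2 * N * C, by positivity, ?_⟩
    intro u hu hu1
    set ε := 1 / (2 * N * (C0 + 1)) with hε
    have hε0 : 0 < ε := by positivity
    have key := En_le k (m + 1) u
      (ε * (C0 * En k (m + 1) u) + C * En k (m + 2) u + ε * En k (m + 1) u) (by
        intro L hL
        match L, hL with
        | i :: L, hL =>
          have hL' : L.length = m := by simpa using hL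
          refine (h u hu hu1 i L hL').trans ?_
          have b1 := (le_En k m u L hL').trans (h0 u hu hu1)
          have b2 := le_En k (m + 2) u (i :: i :: L) (by simp [hL'])
          have b3 := le_En k (m + 1) u (i :: L) hL
          gcongr)
    have e : N * (ε * (C0 * En k (m + 1) u) + C * En k (m + 2) u + ε * En k (m + 1) u)
        = En k (m + 1) u / 2 + N * C * En k (m + 2) u := by
      rw [hε]; field_simp; ring
    rw [e] at key
    linarith

lemma chain_all {n : ℕ} (hn : 1 ≤ n) (k d : ℕ) (hd : d ≤ k) :
    ∃ C : ℝ, 0 ≤ C ∧ ∀ u : (Fin n → ℝ) → ℝ, Good n k u → (∀ x, |u x| ≤ 1) →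
      En k (k - d) u ≤ C * En k k u := by
  induction d with
  | zero => exact ⟨1, by norm_num, fun u _ _ => by simp⟩
  | succ d ih =>
    obtain ⟨C, hC, h⟩ := ih (by omega)
    obtain ⟨C', hC', h'⟩ := chain hn k (k - (d + 1)) (by omega)
    refine ⟨C' * C, by positivity, fun u hu hu1 => ?_⟩
    have a := h' u hu hu1
    have b := h u hu hu1
    rw [show k - (d + 1) + 1 = k - d by omega] at a
    calc _ ≤ _ := a
      _ ≤ C' * (C * En k k u) := by gcongr
      _ = _ := by ring

lemma chain_sum {n : ℕ} (hn : 1 ≤ n) (k : ℕ) :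
    ∃ C : ℝ, 0 ≤ C ∧ ∀ u : (Fin n → ℝ) → ℝ, Good n k u → (∀ x, |u x| ≤ 1) →
      ∑ m ∈ Finset.range (k + 1), En k m u ≤ C * En k k u := by
  have h : ∀ m : Fin (k + 1), ∃ C : ℝ, 0 ≤ C ∧ ∀ u : (Fin n → ℝ) → ℝ, Good n k u →
      (∀ x, |u x| ≤ 1) → En k m u ≤ C * En k k u := fun m => by
    have := chain_all hn k (k - m) (by omega)
    rwa [show k - (k - (m : ℕ)) = m by omega] at this
  choose C hC h using h
  refine ⟨∑ m, C m, Finset.sum_nonneg fun _ _ => hC _, fun u hu hu1 => ?_⟩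
  rw [Finset.sum_range, Finset.sum_mul]
  exact Finset.sum_le_sum fun m _ => h m u hu hu1


/-- Pointwise energy density. -/
noncomputable def HH {n : ℕ} (k : ℕ) (u : (Fin n → ℝ) → ℝ) (x : Fin n → ℝ) : ℝ :=
  ∑ m ∈ Finset.range (k + 1), ∑ w : Fin m → Fin n, FF k m (wd (List.ofFn w) u x)

lemma le_HH {n : ℕ} (k : ℕ) (u : (Fin n → ℝ) → ℝ) (x : Fin n → ℝ) (L : List (Fin n))
    (hL : L.length ≤ k) : FF k L.length (wd L u x) ≤ HH k u x := by
  have h1 := Finset.single_le_sum (f := fun w : Fin L.length → Fin n =>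
    FF k L.length (wd (List.ofFn w) u x))
    (fun _ _ => FF_nonneg _ _ _) (Finset.mem_univ L.get)
  simp only [List.ofFn_get] at h1
  refine h1.trans ?_
  exact Finset.single_le_sum (f := fun m => ∑ w : Fin m → Fin n, FF k m (wd (List.ofFn w) u x))
    (fun _ _ => Finset.sum_nonneg fun _ _ => FF_nonneg _ _ _)
    (Finset.mem_range.mpr (Nat.lt_succ_of_le hL))

lemma HH_int {n k : ℕ} {u : (Fin n → ℝ) → ℝ} (hu : Good n k u) :
    Integrable (HH k u) ∧ ∫ x, HH k u x = ∑ m ∈ Finset.range (k + 1), En k m u := by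
  have h : ∀ m ∈ Finset.range (k + 1), ∀ w ∈ (Finset.univ : Finset (Fin m → Fin n)),
      Integrable fun x => FF k m (wd (List.ofFn w) u x) := fun m hm w _ => by
    have := Finset.mem_range.mp hm
    exact hu.FF_int _ _ (by simp; omega) (by omega)
  constructor
  · exact integrable_finsetSum _ fun m hm => integrable_finsetSum _ (h m hm)
  · unfold HH En
    rw [integral_finsetSum _ fun m hm => integrable_finsetSum _ (h m hm)]
    exact Finset.sum_congr rfl fun m hm => integral_finsetSum _ (h m hm)

lemma prod_le_HH {n k : ℕ} (hk : 0 < k) (u v : (Fin n → ℝ) → ℝ) (hu1 : ∀ x, |u x| ≤ 1)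
    (hv1 : ∀ x, |v x| ≤ 1) (x : Fin n → ℝ) (P Q : List (Fin n)) (h : P.length + Q.length = k) :
    (wd P u x * wd Q v x) ^ 2 ≤ HH k u x + HH k v x := by
  have hkR : (0 : ℝ) < k := by exact_mod_cast hk
  have hsum : (P.length : ℝ) + Q.length = k := by exact_mod_cast h
  have nil : ∀ (f : (Fin n → ℝ) → ℝ) (L : List (Fin n)), (∀ x, |f x| ≤ 1) →
      L.length = 0 → |wd L f x| ≤ 1 := by
    intro f L hf hL
    have := List.length_eq_zero_iff.mp hL
    subst this
    exact hf x
  have a1 := FF_root k P.length hk (wd P u x) (nil u P hu1)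
  have a2 := FF_root k Q.length hk (wd Q v x) (nil v Q hv1)
  have b1 := le_HH k u x P (by omega)
  have b2 := le_HH k v x Q (by omega)
  have c1 := FF_nonneg k P.length (wd P u x)
  have c2 := FF_nonneg k Q.length (wd Q v x)
  set a := FF k P.length (wd P u x)
  set b := FF k Q.length (wd Q v x)
  have sqr : ∀ (c : ℝ) (m : ℕ), 0 ≤ c → (c ^ ((m : ℝ) / (2 * k))) ^ 2 = c ^ ((m : ℝ) / k) := by
    intro c m hc
    rw [← Real.rpow_natCast, ← Real.rpow_mul hc]
    congr 1
    push_cast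
    field_simp
  have amgm := Real.geom_mean_le_arith_mean2_weighted (w₁ := (P.length : ℝ) / k)
    (w₂ := (Q.length : ℝ) / k) (by positivity) (by positivity) c1 c2
    (by rw [← add_div, hsum, div_self hkR.ne'])
  have p1 : (P.length : ℝ) / k ≤ 1 := by
    rw [div_le_one hkR]; linarith [(Nat.cast_nonneg Q.length : (0 : ℝ) ≤ _)]
  have p2 : (Q.length : ℝ) / k ≤ 1 := by
    rw [div_le_one hkR]; linarith [(Nat.cast_nonneg P.length : (0 : ℝ) ≤ _)]
  calc (wd P u x * wd Q v x) ^ 2 = |wd P u x| ^ 2 * |wd Q v x| ^ 2 := by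
        rw [mul_pow, sq_abs, sq_abs]
    _ ≤ (a ^ ((P.length : ℝ) / (2 * k))) ^ 2 * (b ^ ((Q.length : ℝ) / (2 * k))) ^ 2 := by
        gcongr
    _ = a ^ ((P.length : ℝ) / k) * b ^ ((Q.length : ℝ) / k) := by rw [sqr _ _ c1, sqr _ _ c2]
    _ ≤ _ := amgm
    _ ≤ 1 * a + 1 * b := by gcongr
    _ ≤ _ := by linarith

lemma core {n : ℕ} (hn : 1 ≤ n) (k : ℕ) : ∃ C : ℝ, 0 ≤ C ∧ ∀ u v : (Fin n → ℝ) → ℝ,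
    Good n k u → Good n k v → (∀ x, |u x| ≤ 1) → (∀ x, |v x| ≤ 1) → ∀ Su Sv : ℝ,
    (∀ L : List (Fin n), L.length = k → ∫ x, wd L u x ^ 2 ≤ Su) →
    (∀ L : List (Fin n), L.length = k → ∫ x, wd L v x ^ 2 ≤ Sv) →
    ∀ L : List (Fin n), L.length = k →
      ∫ x, wd L (fun y => u y * v y) x ^ 2 ≤ C * (Su + Sv) := by
  rcases Nat.eq_zero_or_pos k with rfl | hk
  · refine ⟨1, by norm_num, ?_⟩
    intro u v hu hv hu1 hv1 Su Sv hSu hSv L hL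
    have := List.length_eq_zero_iff.mp hL
    subst this
    have h1 := hSu [] rfl
    have h2 := hSv [] rfl
    have h3 : 0 ≤ ∫ x, wd [] u x ^ 2 := integral_nonneg fun _ => sq_nonneg _
    have h4 : ∫ x, wd [] (fun y => u y * v y) x ^ 2 ≤ ∫ x, wd [] v x ^ 2 := by
      refine integral_mono_of_nonneg (Filter.Eventually.of_forall fun x => sq_nonneg _)
        (hv.sq [] le_rfl) (Filter.Eventually.of_forall fun x => ?_)
      simp only [wd_nil, mul_pow]
      have : u x ^ 2 ≤ 1 := by rw [← sq_abs]; nlinarith [hu1 x, abs_nonneg (u x)]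
      nlinarith [sq_nonneg (v x)]
    linarith
  · obtain ⟨C, hC, h⟩ := chain_sum hn k
    refine ⟨4 ^ k * (C * (n : ℝ) ^ k), by positivity, ?_⟩
    intro u v hu hv hu1 hv1 Su Sv hSu hSv L hL
    obtain ⟨iu, eu⟩ := HH_int hu
    obtain ⟨iv, ev⟩ := HH_int hv
    have pw : ∀ x, wd L (fun y => u y * v y) x ^ 2 ≤ 4 ^ k * (HH k u x + HH k v x) := by
      intro x
      have hM := prod_le_HH hk u v hu1 hv1 x
      have h0 : 0 ≤ HH k u x + HH k v x := (sq_nonneg _).trans (hM [] L (by simp [hL]))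
      have := leib k u v hu.cd hv.cd x (Real.sqrt (HH k u x + HH k v x))
        (fun P Q hPQ => Real.abs_le_sqrt (hM P Q hPQ)) L [] [] (by simp [hL])
      simp only [wd_nil] at this
      rw [← sq_abs]
      calc _ ≤ (2 ^ L.length * Real.sqrt (HH k u x + HH k v x)) ^ 2 := by gcongr
        _ = _ := by
          rw [mul_pow, Real.sq_sqrt h0, hL, ← pow_mul, mul_comm k 2, pow_mul]; norm_num
    have m1 : ∫ x, wd L (fun y => u y * v y) x ^ 2 ≤ ∫ x, 4 ^ k * (HH k u x + HH k v x) :=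
      integral_mono_of_nonneg (Filter.Eventually.of_forall fun x => sq_nonneg _)
        ((iu.add iv).const_mul _) (Filter.Eventually.of_forall pw)
    rw [integral_const_mul, integral_add iu iv, eu, ev] at m1
    have eU := En_le k k u Su (fun L hL => by simpa only [FF_self k hk] using hSu L hL)
    have eV := En_le k k v Sv (fun L hL => by simpa only [FF_self k hk] using hSv L hL)
    calc _ ≤ _ := m1
      _ ≤ 4 ^ k * (C * En k k u + C * En k k v) := by
        gcongr
        · exact h u hu hu1
        · exact h v hv hv1
      _ ≤ 4 ^ k * (C * ((n : ℝ) ^ k * Su) + C * ((n : ℝ) ^ k * Sv)) := by gcongr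
      _ = _ := by ring

lemma Good.scale {n k : ℕ} {u : (Fin n → ℝ) → ℝ} (hu : Good n k u) (c : ℝ) :
    Good n k (fun x => c * u x) := by
  refine ⟨contDiff_const.mul hu.cd, fun L hL => ?_, fun L hL => ?_⟩
  · obtain ⟨C, hC⟩ := hu.bd L hL
    refine ⟨|c| * C, fun x => ?_⟩
    rw [wd_smul, abs_mul]
    exact mul_le_mul_of_nonneg_left (hC x) (abs_nonneg _)
  · rw [wd_smul]
    simp_rw [mul_pow]
    exact (hu.sq L hL).const_mul _

lemma good_of {n s k : ℕ} (hk : k ≤ s) (u : (Fin n → ℝ) → ℝ) (hc : ContDiff ℝ s u)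
    (h : ∀ α ∈ multiIndices n s,
          (∃ C, ∀ x, |mderiv α u x| ≤ C) ∧ Integrable fun x => mderiv α u x ^ 2) :
    Good n k u := by
  refine ⟨hc.of_le (by exact_mod_cast hk), fun L hL => ?_, fun L hL => ?_⟩
  · rw [wd_eq_mderiv L u (hc.of_le (by exact_mod_cast hL.trans hk))]
    exact (h _ (count_mem L (hL.trans hk))).1
  · rw [wd_eq_mderiv L u (hc.of_le (by exact_mod_cast hL.trans hk))]
    exact (h _ (count_mem L (hL.trans hk))).2

lemma sob_bound {n s : ℕ} (u : (Fin n → ℝ) → ℝ) (hc : ContDiff ℝ s u) (L : List (Fin n))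
    (hL : L.length ≤ s) : ∫ x, wd L u x ^ 2 ≤ sobNorm n s u ^ 2 := by
  unfold sobNorm
  rw [Real.sq_sqrt (Finset.sum_nonneg fun _ _ => integral_nonneg fun _ => sq_nonneg _)]
  rw [wd_eq_mderiv L u (hc.of_le (by exact_mod_cast hL))]
  exact Finset.single_le_sum (f := fun α => ∫ x, mderiv α u x ^ 2)
    (fun _ _ => integral_nonneg fun _ => sq_nonneg _) (count_mem L hL)

lemma linf_nonneg {n : ℕ} (u : (Fin n → ℝ) → ℝ) : 0 ≤ LinfNorm u :=
  Real.iSup_nonneg fun _ => abs_nonneg _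

lemma le_linf {n k : ℕ} {u : (Fin n → ℝ) → ℝ} (hu : Good n k u) (x : Fin n → ℝ) :
    |u x| ≤ LinfNorm u := by
  obtain ⟨C, hC⟩ := hu.bd [] (by simp)
  exact le_ciSup (f := fun x => |u x|) ⟨C, by rintro _ ⟨y, rfl⟩; exact hC y⟩ x

lemma wd_zero {n : ℕ} (L : List (Fin n)) (f : (Fin n → ℝ) → ℝ) (hf : ∀ x, f x = 0) :
    L2norm (wd L f) = 0 := by
  have : f = fun x => 0 * f x := by funext x; simp [hf x]
  rw [this, wd_smul]
  simp [L2norm]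

/-- Moser-type product estimate. -/
theorem moser_product (n s : ℕ) (hn : 1 ≤ n) (hs : 1 ≤ s) :
    ∃ c : ℝ, 0 < c ∧
      ∀ u v : (Fin n → ℝ) → ℝ,
        ContDiff ℝ s u → ContDiff ℝ s v →
        (∀ α ∈ multiIndices n s,
          (∃ C, ∀ x, |mderiv α u x| ≤ C) ∧ Integrable fun x => mderiv α u x ^ 2) →
        (∀ α ∈ multiIndices n s,
          (∃ C, ∀ x, |mderiv α v x| ≤ C) ∧ Integrable fun x => mderiv α v x ^ 2) →
        ∀ α ∈ multiIndices n s,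
          L2norm (mderiv α fun x => u x * v x) ≤
            c * (LinfNorm u * sobNorm n s v + LinfNorm v * sobNorm n s u) := by
  choose C hC hcore using fun k => core (n := n) hn k
  refine ⟨1 + ∑ k ∈ Finset.range (s + 1), Real.sqrt (C k),
    add_pos_of_pos_of_nonneg one_pos (Finset.sum_nonneg fun _ _ => Real.sqrt_nonneg _), ?_⟩
  intro u v hu hv bu bv α hα
  have hαs : ∑ i, α i ≤ s := (Finset.mem_filter.mp hα).2
  rw [mderiv_eq_wd]
  have hlen := canon_length α
  set L := canon α
  set k := ∑ i, α i
  have gu := good_of hαs u hu bu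
  have gv := good_of hαs v hv bv
  have hA0 := linf_nonneg u
  have hB0 := linf_nonneg v
  have hA := le_linf gu
  have hB := le_linf gv
  have hS0 : 0 ≤ sobNorm n s u := Real.sqrt_nonneg _
  have hT0 : 0 ≤ sobNorm n s v := Real.sqrt_nonneg _
  have hSu := fun (L : List (Fin n)) (h : L.length = k) => sob_bound u hu L (h.trans_le hαs)
  have hSv := fun (L : List (Fin n)) (h : L.length = k) => sob_bound v hv L (h.trans_le hαs)
  set A := LinfNorm u
  set B := LinfNorm v
  set S := sobNorm n s u
  set T := sobNorm n s v
  have hc0 : Real.sqrt (C k) ≤ 1 + ∑ k ∈ Finset.range (s + 1), Real.sqrt (C k) := by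
    have := Finset.single_le_sum (f := fun k => Real.sqrt (C k))
      (fun _ _ => Real.sqrt_nonneg _) (Finset.mem_range.mpr (Nat.lt_succ_of_le hαs))
    linarith
  have hX : 0 ≤ A * T + B * S := by positivity
  refine le_trans ?_ (mul_le_mul_of_nonneg_right hc0 hX)
  rcases hA0.eq_or_lt with h | hApos
  · rw [wd_zero L _ fun x => by
      have := hA x
      rw [← h] at this
      simp [abs_nonpos_iff.mp this]]
    positivity
  rcases hB0.eq_or_lt with h | hBpos
  · rw [wd_zero L _ fun x => by
      have := hB x
      rw [← h] at this
      simp [abs_nonpos_iff.mp this]]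
    positivity
  have scaled : ∀ (f : (Fin n → ℝ) → ℝ) (a R : ℝ), (∀ L : List (Fin n), L.length = k →
      ∫ x, wd L f x ^ 2 ≤ R ^ 2) → ∀ L : List (Fin n), L.length = k →
      ∫ x, wd L (fun y => a⁻¹ * f y) x ^ 2 ≤ (a⁻¹ * R) ^ 2 := by
    intro f a R h L hL
    rw [wd_smul]
    simp_rw [mul_pow]
    rw [integral_const_mul]
    exact mul_le_mul_of_nonneg_left (h L hL) (sq_nonneg _)
  have main := hcore k _ _ (gu.scale A⁻¹) (gv.scale B⁻¹)
    (fun x => by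
      rw [abs_mul, abs_of_pos (inv_pos.mpr hApos), inv_mul_le_one₀ hApos]; exact hA x)
    (fun x => by
      rw [abs_mul, abs_of_pos (inv_pos.mpr hBpos), inv_mul_le_one₀ hBpos]; exact hB x)
    _ _ (scaled u A S hSu) (scaled v B T hSv) L hlen
  have e : (fun x => u x * v x) = fun x => (A * B) * (A⁻¹ * u x * (B⁻¹ * v x)) := by
    funext x; field_simp
  unfold L2norm
  rw [Real.sqrt_le_left (by positivity), e, wd_smul]
  simp_rw [mul_pow (A * B)]
  rw [integral_const_mul, mul_pow (√(C k)), Real.sq_sqrt (hC k)]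
  calc _ ≤ (A * B) ^ 2 * (C k * ((A⁻¹ * S) ^ 2 + (B⁻¹ * T) ^ 2)) := by gcongr
    _ = C k * ((B * S) ^ 2 + (A * T) ^ 2) := by field_simp
    _ ≤ _ := by
      apply mul_le_mul_of_nonneg_left _ (hC k)
      have : 0 ≤ (A * T) * (B * S) := by positivity
      nlinarith
end

section
/- Lower bound for the relative pressure potential: let a > 0, γ > 1 and r > 0. There exists a constant c > 0, depending only on a, γ and r, such that for every ρ ≥ 0: if r/2 ≤ ρ ≤ 2r then H(ρ, r) ≥ c (ρ − r)², and if ρ < r/2 or ρ > 2r then H(ρ, r) ≥ c (1 + ρ^γ). -/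
/-- The relative pressure potential `H(ρ, r)` associated with the pressure `p(ρ) = a ρ^γ`. -/
noncomputable def Hrel (a γ ρ r : ℝ) : ℝ :=
  a / (γ - 1) * (ρ ^ γ - γ * r ^ (γ - 1) * (ρ - r) - r ^ γ)

open Set in
theorem Hrel_aux_quad (γ r : ℝ) (hγ : 1 < γ) (hr : 0 < r) :
    ∃ k : ℝ, 0 < k ∧ ∀ x : ℝ, r / 2 ≤ x → x ≤ 2 * r →
      k * (x - r) ^ 2 ≤ x ^ γ - γ * r ^ (γ - 1) * (x - r) - r ^ γ := by
  have hpos : ∀ x ∈ Icc (r / 2) (2 * r), 0 < x := fun x hx => by linarith [hx.1]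
  obtain ⟨x₀, hx₀, hmin⟩ := (isCompact_Icc (a := r / 2) (b := 2 * r)).exists_isMinOn
    ⟨r, by constructor <;> linarith⟩
    (f := fun x : ℝ => x ^ (γ - 2))
    (fun x hx => (Real.continuousAt_rpow_const x _ (Or.inl (hpos x hx).ne')).continuousWithinAt)
  have hm : 0 < x₀ ^ (γ - 2) := Real.rpow_pos_of_pos (hpos _ hx₀) _
  set m := x₀ ^ (γ - 2) with hmdef
  have hg : 0 < γ * (γ - 1) := mul_pos (by linarith) (by linarith)
  refine ⟨γ * (γ - 1) * m / 2, by positivity, ?_⟩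
  set k := γ * (γ - 1) * m / 2 with hk
  let f : ℝ → ℝ := fun x => x ^ γ - γ * r ^ (γ - 1) * (x - r) - r ^ γ - k * (x - r) ^ 2
  have hd : ∀ x : ℝ, 0 < x →
      HasDerivAt f (γ * x ^ (γ - 1) - γ * r ^ (γ - 1) - 2 * k * (x - r)) x := by
    intro x hx
    have h1 := Real.hasDerivAt_rpow_const (x := x) (p := γ) (Or.inl hx.ne')
    have h2 := (hasDerivAt_id' x).sub_const r
    have := ((h1.sub (h2.const_mul (γ * r ^ (γ - 1)))).sub_const (r ^ γ)).sub
      ((h2.pow 2).const_mul k)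
    refine this.congr_deriv ?_
    simp
    ring
  have hd2 : ∀ x : ℝ, 0 < x →
      HasDerivAt (fun x : ℝ => γ * x ^ (γ - 1) - γ * r ^ (γ - 1) - 2 * k * (x - r))
        (γ * (γ - 1) * x ^ (γ - 2) - 2 * k) x := by
    intro x hx
    have h1 := Real.hasDerivAt_rpow_const (x := x) (p := γ - 1) (Or.inl hx.ne')
    have h2 := (hasDerivAt_id' x).sub_const r
    have := ((h1.const_mul γ).sub_const (γ * r ^ (γ - 1))).sub (h2.const_mul (2 * k))
    refine this.congr_deriv ?_
    rw [show γ - 1 - 1 = γ - 2 by ring]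
    ring
  have hconv : ConvexOn ℝ (Icc (r / 2) (2 * r)) f := by
    refine convexOn_of_hasDerivWithinAt2_nonneg (convex_Icc _ _)
      (fun x hx => (hd x (hpos x hx)).continuousAt.continuousWithinAt)
      (fun x hx => (hd x (hpos x (interior_subset hx))).hasDerivWithinAt)
      (fun x hx => (hd2 x (hpos x (interior_subset hx))).hasDerivWithinAt) ?_
    intro x hx
    have h : m ≤ x ^ (γ - 2) := hmin (interior_subset hx)
    have := mul_le_mul_of_nonneg_left h hg.le
    rw [hk]
    linarith
  have hmn : IsMinOn f (Icc (r / 2) (2 * r)) r := by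
    refine hconv.isMinOn_of_rightDeriv_eq_zero ?_ ?_
    · rw [interior_Icc]
      constructor <;> linarith
    · rw [(hd r hr).hasDerivWithinAt.derivWithin (uniqueDiffWithinAt_Ioi r)]
      ring
  intro x h1 h2
  have h : f r ≤ f x := hmn ⟨h1, h2⟩
  simp only [f] at h
  have e : r ^ γ - γ * r ^ (γ - 1) * (r - r) - r ^ γ - k * (r - r) ^ 2 = 0 := by ring
  linarith

theorem Hrel_aux_tangent (γ y x : ℝ) (hγ : 1 < γ) (hy : 0 < y) (hx : 0 ≤ x) (hxy : x ≠ y) :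
    0 < x ^ γ - γ * y ^ (γ - 1) * (x - y) - y ^ γ := by
  have hs : -1 ≤ x / y - 1 := by
    have : 0 ≤ x / y := by positivity
    linarith
  have hs' : x / y - 1 ≠ 0 := by
    intro h
    exact hxy ((div_eq_one_iff_eq hy.ne').1 (by linarith))
  have h := one_add_mul_self_lt_rpow_one_add hs hs' hγ
  rw [show 1 + (x / y - 1) = x / y by ring, Real.div_rpow hx hy.le,
    lt_div_iff₀ (Real.rpow_pos_of_pos hy _)] at h
  have e : y ^ γ = y ^ (γ - 1) * y := by
    rw [Real.rpow_sub_one hy.ne']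
    field_simp
  have e2 : (1 + γ * (x / y - 1)) * y ^ γ = γ * y ^ (γ - 1) * (x - y) + y ^ γ := by
    rw [e]
    field_simp
    ring
  linarith

open Set in
theorem Hrel_aux_small (γ r : ℝ) (hγ : 1 < γ) (hr : 0 < r) :
    ∃ k : ℝ, 0 < k ∧ ∀ x : ℝ, 0 ≤ x → x < r / 2 →
      k * (1 + x ^ γ) ≤ x ^ γ - γ * r ^ (γ - 1) * (x - r) - r ^ γ := by
  have hc : Continuous fun x : ℝ => x ^ γ := Real.continuous_rpow_const (by linarith)
  obtain ⟨x₀, hx₀, hmin⟩ := (isCompact_Icc (a := 0) (b := r / 2)).exists_isMinOn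
    ⟨0, by constructor <;> linarith⟩
    (f := fun x : ℝ => x ^ γ - γ * r ^ (γ - 1) * (x - r) - r ^ γ)
    (by fun_prop)
  have hm := Hrel_aux_tangent γ r x₀ hγ hr hx₀.1 (by linarith [hx₀.2])
  set m := x₀ ^ γ - γ * r ^ (γ - 1) * (x₀ - r) - r ^ γ with hmdef
  have hR : 0 < 1 + r ^ γ := by positivity
  refine ⟨m / (1 + r ^ γ), by positivity, fun x hx hx2 => ?_⟩
  have h : m ≤ x ^ γ - γ * r ^ (γ - 1) * (x - r) - r ^ γ := hmin ⟨hx, hx2.le⟩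
  refine le_trans ?_ h
  have h3 : x ^ γ ≤ r ^ γ := Real.rpow_le_rpow hx (by linarith) (by linarith)
  calc m / (1 + r ^ γ) * (1 + x ^ γ) ≤ m / (1 + r ^ γ) * (1 + r ^ γ) := by gcongr
    _ = m := by field_simp

theorem Hrel_aux_large (γ r : ℝ) (hγ : 1 < γ) (hr : 0 < r) :
    ∃ k : ℝ, 0 < k ∧ ∀ x : ℝ, 2 * r < x →
      k * (1 + x ^ γ) ≤ x ^ γ - γ * r ^ (γ - 1) * (x - r) - r ^ γ := by
  have hP : 1 + γ < (2 : ℝ) ^ γ := by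
    have := one_add_mul_self_lt_rpow_one_add (s := 1) (by norm_num) one_ne_zero hγ
    norm_num at this
    exact this
  have e2 : (2 : ℝ) ^ (γ - 1) = 2 ^ γ / 2 := Real.rpow_sub_one (by norm_num) _
  have e : r ^ γ = r ^ (γ - 1) * r := by
    rw [Real.rpow_sub_one hr.ne']
    field_simp
  have hq : 0 < r ^ (γ - 1) := Real.rpow_pos_of_pos hr _
  have hrg : 0 < r ^ γ := Real.rpow_pos_of_pos hr _
  have ht : ∀ x : ℝ, 2 * r < x → (2 : ℝ) ^ γ *
      (r ^ (γ - 1) * r + γ / 2 * r ^ (γ - 1) * (x - 2 * r)) ≤ x ^ γ := by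
    intro x hx
    have := Hrel_aux_tangent γ (2 * r) x hγ (by linarith) (by linarith) hx.ne'
    rw [Real.mul_rpow (by norm_num) hr.le, Real.mul_rpow (by norm_num) hr.le, e2, e] at this
    linarith
  generalize (2 : ℝ) ^ γ = P at *
  have hP0 : 0 < P := by linarith
  have hδ : 0 < 1 - (1 + γ) / P := by
    rw [sub_pos, div_lt_one hP0]
    exact hP
  refine ⟨(1 - (1 + γ) / P) * (r ^ γ / (1 + r ^ γ)), by positivity, fun x hx => ?_⟩
  have h := ht x hx
  have hxr : r ^ γ ≤ x ^ γ := Real.rpow_le_rpow hr.le (by linarith) (by linarith)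
  have h1 : (1 - (1 + γ) / P) * x ^ γ ≤ x ^ γ - γ * r ^ (γ - 1) * (x - r) - r ^ γ := by
    have h2 : (1 + γ) * (r ^ (γ - 1) * r + γ / 2 * r ^ (γ - 1) * (x - 2 * r))
        ≤ (1 + γ) / P * x ^ γ := by
      rw [div_mul_eq_mul_div (1 + γ) P (x ^ γ), le_div_iff₀ hP0]
      have := mul_le_mul_of_nonneg_left h (show 0 ≤ 1 + γ by linarith)
      linarith
    have h3 : 0 ≤ (γ - 1) * (γ / 2 * r ^ (γ - 1) * (x - 2 * r)) :=
      mul_nonneg (by linarith) (mul_nonneg (by positivity) (by linarith))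
    rw [e]
    linarith
  refine le_trans ?_ h1
  rw [mul_assoc]
  refine mul_le_mul_of_nonneg_left ?_ hδ.le
  rw [div_mul_eq_mul_div, div_le_iff₀ (by positivity)]
  linarith

/-- Lower bound for the relative pressure potential. -/
theorem Hrel_lower_bound (a γ r : ℝ) (ha : 0 < a) (hγ : 1 < γ) (hr : 0 < r) :
    ∃ c : ℝ, 0 < c ∧ ∀ ρ : ℝ, 0 ≤ ρ →
      ((r / 2 ≤ ρ ∧ ρ ≤ 2 * r → c * (ρ - r) ^ 2 ≤ Hrel a γ ρ r) ∧
        (ρ < r / 2 ∨ 2 * r < ρ → c * (1 + ρ ^ γ) ≤ Hrel a γ ρ r)) := by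
  obtain ⟨k₁, hk₁, H₁⟩ := Hrel_aux_quad γ r hγ hr
  obtain ⟨k₂, hk₂, H₂⟩ := Hrel_aux_small γ r hγ hr
  obtain ⟨k₃, hk₃, H₃⟩ := Hrel_aux_large γ r hγ hr
  have hA : 0 < a / (γ - 1) := div_pos ha (by linarith)
  refine ⟨a / (γ - 1) * min k₁ (min k₂ k₃),
    mul_pos hA (lt_min hk₁ (lt_min hk₂ hk₃)), fun ρ hρ => ?_⟩
  have hp : 0 ≤ 1 + ρ ^ γ := by positivity
  unfold Hrel
  simp only [mul_assoc (a / (γ - 1))]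
  refine ⟨fun h => ?_, fun h => ?_⟩
  · refine mul_le_mul_of_nonneg_left (le_trans ?_ (H₁ ρ h.1 h.2)) hA.le
    exact mul_le_mul_of_nonneg_right (min_le_left _ _) (sq_nonneg _)
  · refine mul_le_mul_of_nonneg_left ?_ hA.le
    rcases h with h | h
    · refine le_trans ?_ (H₂ ρ hρ h)
      exact mul_le_mul_of_nonneg_right ((min_le_right _ _).trans (min_le_left _ _)) hp
    · refine le_trans ?_ (H₃ ρ h)
      exact mul_le_mul_of_nonneg_right ((min_le_right _ _).trans (min_le_right _ _)) hp
end

section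
/- Pointwise distance bound by the relative pressure potential: let a > 0, γ > 1 and r > 0. There exists a constant C > 0, depending only on a, γ and r, such that for every ρ ≥ 0: if |ρ − r| ≤ 1 then (ρ − r)² ≤ C · H(ρ, r), and if |ρ − r| > 1 then |ρ − r|^γ ≤ C · H(ρ, r). -/
theorem bern_quad (γ : ℝ) (hγ : 1 < γ) : ∃ c : ℝ, 0 < c ∧ ∀ x : ℝ, 0 ≤ x →
    c * (x - 1) ^ 2 ≤ (1 + x) * (x ^ γ - 1 - γ * (x - 1)) := by
  rcases le_or_gt 2 γ with h2 | h2
  · refine ⟨γ / 2, by linarith, fun x hx => ?_⟩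
    have h := one_add_mul_self_le_rpow_one_add (s := x ^ 2 - 1) (by nlinarith [sq_nonneg x])
      (p := γ / 2) (by linarith)
    have e : (1 + (x ^ 2 - 1)) ^ (γ / 2) = x ^ γ := by
      rw [add_sub_cancel, ← Real.rpow_natCast, ← Real.rpow_mul hx]
      congr 1
      push_cast
      ring
    rw [e] at h
    have h3 : γ / 2 * (x - 1) ^ 2 ≤ x ^ γ - 1 - γ * (x - 1) := by nlinarith
    have h4 : 0 ≤ γ / 2 * (x - 1) ^ 2 := by positivity
    nlinarith
  · refine ⟨(γ - 1) ^ 2, by have : 0 < γ - 1 := by linarith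
                            positivity, fun x hx => ?_⟩
    have h := rpow_one_add_le_one_add_mul_self (s := x - 1) (by linarith)
      (p := 2 - γ) (by linarith) (by linarith)
    rw [add_sub_cancel] at h
    have hp : 0 ≤ x ^ γ := Real.rpow_nonneg hx _
    have e : x ^ γ * x ^ (2 - γ) = x ^ 2 := by
      rw [← Real.rpow_add' hx (by norm_num), ← Real.rpow_natCast]
      congr 1
      push_cast
      ring
    have h3 := mul_le_mul_of_nonneg_left h hp
    rw [e] at h3
    have hD : 0 < 1 + (2 - γ) * (x - 1) := by nlinarith [mul_nonneg (sub_nonneg.2 h2.le) hx]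
    have hD2 : 1 + (2 - γ) * (x - 1) ≤ 1 + x := by nlinarith
    have h5 : (γ - 1) ^ 2 * (x - 1) ^ 2 ≤
        (1 + (2 - γ) * (x - 1)) * (x ^ γ - 1 - γ * (x - 1)) := by nlinarith
    have h6 : 0 ≤ x ^ γ - 1 - γ * (x - 1) := by
      have := one_add_mul_self_le_rpow_one_add (s := x - 1) (by linarith) hγ.le
      rw [add_sub_cancel] at this
      linarith
    exact h5.trans (mul_le_mul_of_nonneg_right hD2 h6)

theorem bern_far (γ : ℝ) (hγ : 1 < γ) : ∃ K : ℝ, 1 ≤ K ∧ ∀ x : ℝ, K ≤ x →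
    x ^ γ ≤ 2 * (x ^ γ - 1 - γ * (x - 1)) := by
  have hg : 0 < γ - 1 := by linarith
  refine ⟨(2 * γ) ^ (1 / (γ - 1)), Real.one_le_rpow (by linarith) (by positivity), fun x hx => ?_⟩
  have h0 : 0 < (2 * γ) ^ (1 / (γ - 1)) := Real.rpow_pos_of_pos (by linarith) _
  have hx0 : 0 < x := h0.trans_le hx
  have h := Real.rpow_le_rpow h0.le hx hg.le
  rw [← Real.rpow_mul (by linarith), one_div_mul_cancel hg.ne', Real.rpow_one] at h
  have e : x ^ γ = x ^ (γ - 1) * x := by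
    rw [← Real.rpow_add_one hx0.ne']
    congr 1
    ring
  have := mul_le_mul_of_nonneg_right h hx0.le
  rw [← e] at this
  nlinarith

/-- Pointwise distance bound by the relative pressure potential. -/
theorem dist_le_Hrel (a γ r : ℝ) (ha : 0 < a) (hγ : 1 < γ) (hr : 0 < r) :
    ∃ C : ℝ, 0 < C ∧ ∀ ρ : ℝ, 0 ≤ ρ →
      ((|ρ - r| ≤ 1 → (ρ - r) ^ 2 ≤ C * Hrel a γ ρ r) ∧
        (1 < |ρ - r| → |ρ - r| ^ γ ≤ C * Hrel a γ ρ r)) := by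
  obtain ⟨c, hc, hq⟩ := bern_quad γ hγ
  obtain ⟨K, hK, hf⟩ := bern_far γ hγ
  have hg : 0 < γ - 1 := by linarith
  have hrg : 0 < r ^ γ := Real.rpow_pos_of_pos hr _
  have hKg : 0 < (1 + K) ^ γ := Real.rpow_pos_of_pos (by linarith) _
  have hK1 : 0 < 1 + K := by linarith
  obtain ⟨A1, hA1⟩ : ∃ A, A = r ^ 2 * (2 + 1 / r) / c := ⟨_, rfl⟩
  obtain ⟨A2, hA2⟩ : ∃ A, A = 2 * r ^ γ := ⟨_, rfl⟩
  obtain ⟨A3, hA3⟩ : ∃ A, A = r ^ γ * (1 + K) ^ γ * ((1 + K) * r ^ 2 / c) := ⟨_, rfl⟩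
  have p1 : 0 < A1 := by rw [hA1]; positivity
  have p2 : 0 < A2 := by rw [hA2]; positivity
  have p3 : 0 < A3 := by rw [hA3]; positivity
  refine ⟨(A1 + A2 + A3) * ((γ - 1) / (a * r ^ γ)), by positivity, fun ρ hρ => ?_⟩
  obtain ⟨x, rfl⟩ : ∃ x, ρ = r * x := ⟨ρ / r, by field_simp⟩
  have hx : 0 ≤ x := nonneg_of_mul_nonneg_right hρ hr
  have hE : (A1 + A2 + A3) * ((γ - 1) / (a * r ^ γ)) * Hrel a γ (r * x) r
      = (A1 + A2 + A3) * (x ^ γ - 1 - γ * (x - 1)) := by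
    have e : r ^ (γ - 1) = r ^ γ / r := Real.rpow_sub_one hr.ne' _
    rw [Hrel, e, Real.mul_rpow hr.le hx]
    field_simp
    ring
  rw [hE]
  have hq := hq x hx
  have hf := hf x
  have hF : 0 ≤ x ^ γ - 1 - γ * (x - 1) := by
    have := one_add_mul_self_le_rpow_one_add (s := x - 1) (by linarith) hγ.le
    rw [add_sub_cancel] at this
    linarith
  generalize hFF : x ^ γ - 1 - γ * (x - 1) = F at *
  have q1 := mul_nonneg p1.le hF
  have q2 := mul_nonneg p2.le hF
  have q3 := mul_nonneg p3.le hF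
  have er : r * x - r = r * (x - 1) := by ring
  rw [er]
  constructor
  · intro h
    have h1 := (abs_le.1 h).2
    have hx2 : 1 + x ≤ 2 + 1 / r := by
      have : x - 1 ≤ 1 / r := by rw [le_div_iff₀ hr]; linarith
      linarith
    have : (r * (x - 1)) ^ 2 ≤ A1 * F := by
      have h3 := hq.trans (mul_le_mul_of_nonneg_right hx2 hF)
      have h4 : (x - 1) ^ 2 ≤ (2 + 1 / r) * F / c := by rw [le_div_iff₀ hc]; linarith
      calc (r * (x - 1)) ^ 2 = r ^ 2 * (x - 1) ^ 2 := by ring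
        _ ≤ r ^ 2 * ((2 + 1 / r) * F / c) := by gcongr
        _ = A1 * F := by rw [hA1]; ring
    linarith
  · intro h
    rw [abs_mul, abs_of_pos hr] at h ⊢
    rw [Real.mul_rpow hr.le (abs_nonneg _)]
    rcases le_total K x with hKx | hKx
    · have h1 : |x - 1| ^ γ ≤ x ^ γ := by
        apply Real.rpow_le_rpow (abs_nonneg _) _ (by linarith)
        rw [abs_of_nonneg (by linarith)]
        linarith
      have : r ^ γ * |x - 1| ^ γ ≤ A2 * F := by
        calc _ ≤ r ^ γ * (2 * F) := by gcongr; exact h1.trans (hf hKx)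
          _ = A2 * F := by rw [hA2]; ring
      linarith
    · have h1 : |x - 1| ^ γ ≤ (1 + K) ^ γ := by
        apply Real.rpow_le_rpow (abs_nonneg _) _ (by linarith)
        rw [abs_le]
        constructor <;> linarith
      have h2 : 1 ≤ r ^ 2 * (x - 1) ^ 2 := by
        rw [← sq_abs (x - 1), ← mul_pow]
        exact one_le_pow₀ h.le
      have h3 : (x - 1) ^ 2 ≤ (1 + K) * F / c := by
        rw [le_div_iff₀ hc]
        have : (1 + x) * F ≤ (1 + K) * F := by gcongr
        linarith
      have h4 : 1 ≤ (1 + K) * r ^ 2 / c * F := by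
        calc 1 ≤ _ := h2
          _ ≤ r ^ 2 * ((1 + K) * F / c) := by gcongr
          _ = _ := by ring
      have : r ^ γ * |x - 1| ^ γ ≤ A3 * F := by
        calc r ^ γ * |x - 1| ^ γ ≤ r ^ γ * (1 + K) ^ γ * 1 := by rw [mul_one]; gcongr
          _ ≤ r ^ γ * (1 + K) ^ γ * ((1 + K) * r ^ 2 / c * F) := by gcongr
          _ = A3 * F := by rw [hA3]; ring
      linarith
end

section
/- Cancellation identity in the energy estimate: let n ≥ 1, let u, w : ℝⁿ → ℝⁿ be continuously differentiable vector fields and g, r : ℝⁿ → ℝ continuously differentiable functions, where w and g have compact support and u, r and their first derivatives are bounded. Then ∫_{ℝⁿ} [ ((u·∇)w) · w + r (∇g) · w ] dx = − ½ ∫_{ℝⁿ} (div u) |w|² dx − ∫_{ℝⁿ} r (div w) g dx − ∫_{ℝⁿ} (∇r · w) g dx. -/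
open MeasureTheory

lemma integrable_of_C0 {n : ℕ} {f : (Fin n → ℝ) → ℝ} (hf : Continuous f)
    (hs : HasCompactSupport f) : Integrable f :=
  hf.integrable_of_hasCompactSupport hs

lemma continuous_pd {n : ℕ} {f : (Fin n → ℝ) → ℝ} (hf : ContDiff ℝ 1 f) (v : Fin n → ℝ) :
    Continuous (fun x => fderiv ℝ f x v) :=
  (hf.continuous_fderiv one_ne_zero).clm_apply continuous_const

lemma integrable_pd {n : ℕ} {f : (Fin n → ℝ) → ℝ} (hf : ContDiff ℝ 1 f)
    (hs : HasCompactSupport f) (v : Fin n → ℝ) :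
    Integrable (fun x => fderiv ℝ f x v) :=
  integrable_of_C0 (continuous_pd hf v) (hs.fderiv_apply (𝕜 := ℝ) v)

lemma integral_pd {n : ℕ} {f : (Fin n → ℝ) → ℝ} (hf : ContDiff ℝ 1 f)
    (hs : HasCompactSupport f) (v : Fin n → ℝ) :
    ∫ x, fderiv ℝ f x v = 0 := by
  have h := integral_mul_fderiv_eq_neg_fderiv_mul_of_integrable (μ := volume)
    (f := fun _ : Fin n → ℝ => (1 : ℝ)) (g := f) (v := v) (𝕜 := ℝ)
    (by simp) (by simpa using integrable_pd hf hs v)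
    (by simpa using integrable_of_C0 hf.continuous hs)
    (fun _ _ => differentiableAt_const _) (fun x _ => hf.differentiable one_ne_zero x)
  simpa using h



/-- Cancellation identity in the energy estimate:
`∫ [((u·∇)w)·w + r (∇g)·w] dx = −½∫ (div u)|w|² dx − ∫ r (div w) g dx − ∫ (∇r·w) g dx`. -/
theorem energy_cancellation_identity (n : ℕ) (hn : 1 ≤ n)
    (u w : (Fin n → ℝ) → Fin n → ℝ) (g r : (Fin n → ℝ) → ℝ)
    (hu : ContDiff ℝ 1 u) (hw : ContDiff ℝ 1 w)
    (hg : ContDiff ℝ 1 g) (hr : ContDiff ℝ 1 r)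
    (hwsupp : HasCompactSupport w) (hgsupp : HasCompactSupport g)
    (hub : ∃ C, ∀ x, ‖u x‖ ≤ C ∧ ‖fderiv ℝ u x‖ ≤ C)
    (hrb : ∃ C, ∀ x, |r x| ≤ C ∧ ‖fderiv ℝ r x‖ ≤ C) :
    ∫ x, ((∑ i, ∑ j, u x i * fderiv ℝ (fun y => w y j) x (Pi.single i 1) * w x j)
        + r x * ∑ i, fderiv ℝ g x (Pi.single i 1) * w x i) =
      -(1 / 2 : ℝ) *
          (∫ x, (∑ i, fderiv ℝ (fun y => u y i) x (Pi.single i 1)) * ∑ j, w x j ^ 2)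
        - (∫ x, r x * (∑ i, fderiv ℝ (fun y => w y i) x (Pi.single i 1)) * g x)
        - ∫ x, (∑ i, fderiv ℝ r x (Pi.single i 1) * w x i) * g x := by

  have hui : ∀ i, ContDiff ℝ 1 (fun y => u y i) := fun i => contDiff_pi.1 hu i
  have hwi : ∀ i, ContDiff ℝ 1 (fun y => w y i) := fun i => contDiff_pi.1 hw i
  have hq : ContDiff ℝ 1 (fun y => ∑ j, w y j ^ 2) :=
    ContDiff.sum fun j _ => (hwi j).pow 2
  have hqs : HasCompactSupport (fun y => ∑ j, w y j ^ 2) :=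
    hwsupp.comp_left (g := fun z : Fin n → ℝ => ∑ j, z j ^ 2) (by simp)
  let F : Fin n → (Fin n → ℝ) → ℝ :=
    fun i y => 1 / 2 * (u y i * ∑ j, w y j ^ 2) + r y * w y i * g y
  have hF : ∀ i, ContDiff ℝ 1 (F i) := fun i =>
    (contDiff_const.mul ((hui i).mul hq)).add ((hr.mul (hwi i)).mul hg)
  have hFs : ∀ i, HasCompactSupport (F i) := fun i =>
    HasCompactSupport.add (hqs.mul_left.mul_left) hgsupp.mul_left
  have hdF : ∀ i x, fderiv ℝ (F i) x (Pi.single i 1) =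
      1 / 2 * (fderiv ℝ (fun y => u y i) x (Pi.single i 1) * ∑ j, w x j ^ 2)
      + (∑ j, u x i * fderiv ℝ (fun y => w y j) x (Pi.single i 1) * w x j)
      + r x * (fderiv ℝ g x (Pi.single i 1) * w x i)
      + r x * fderiv ℝ (fun y => w y i) x (Pi.single i 1) * g x
      + fderiv ℝ r x (Pi.single i 1) * w x i * g x := by
    intro i x
    have du := ((hui i).differentiable one_ne_zero x).hasFDerivAt
    have dw := fun j => ((hwi j).differentiable one_ne_zero x).hasFDerivAt
    have dg := (hg.differentiable one_ne_zero x).hasFDerivAt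
    have dr := (hr.differentiable one_ne_zero x).hasFDerivAt
    have dq := HasFDerivAt.fun_sum (u := Finset.univ) fun j _ => (dw j).pow 2
    have := (((du.mul dq).const_mul (1 / 2 : ℝ)).add ((dr.mul (dw i)).mul dg)).fderiv
    have e : F i = _ := rfl
    erw [this]
    simp
    have : ∑ j, u x i * fderiv ℝ (fun y => w y j) x (Pi.single i 1) * w x j =
      1 / 2 * (u x i * ∑ j, 2 * w x j * fderiv ℝ (fun y => w y j) x (Pi.single i 1)) := by
      rw [Finset.mul_sum, Finset.mul_sum]
      exact Finset.sum_congr rfl fun j _ => by ring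
    rw [this]
    ring
  have h0 : ∫ x, ∑ i, fderiv ℝ (F i) x (Pi.single i 1) = 0 := by
    rw [integral_finsetSum _ fun i _ => integrable_pd (hF i) (hFs i) _]
    exact Finset.sum_eq_zero fun i _ => integral_pd (hF i) (hFs i) _
  have iS : Integrable (fun x => ∑ i, fderiv ℝ (F i) x (Pi.single i 1)) :=
    integrable_finsetSum _ fun i _ => integrable_pd (hF i) (hFs i) _
  have iB : Integrable
      (fun x => (∑ i, fderiv ℝ (fun y => u y i) x (Pi.single i 1)) * ∑ j, w x j ^ 2) :=
    integrable_of_C0 ((continuous_finsetSum _ fun i _ => continuous_pd (hui i) _).mul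
      hq.continuous) hqs.mul_left
  have iC : Integrable
      (fun x => r x * (∑ i, fderiv ℝ (fun y => w y i) x (Pi.single i 1)) * g x) :=
    integrable_of_C0 ((hr.continuous.mul
      (continuous_finsetSum _ fun i _ => continuous_pd (hwi i) _)).mul hg.continuous)
      hgsupp.mul_left
  have iD : Integrable (fun x => (∑ i, fderiv ℝ r x (Pi.single i 1) * w x i) * g x) :=
    integrable_of_C0 ((continuous_finsetSum _ fun i _ =>
      (continuous_pd hr _).mul (hwi i).continuous).mul hg.continuous) hgsupp.mul_left
  have key : ∀ x, ((∑ i, ∑ j, u x i * fderiv ℝ (fun y => w y j) x (Pi.single i 1) * w x j)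
        + r x * ∑ i, fderiv ℝ g x (Pi.single i 1) * w x i) =
      (∑ i, fderiv ℝ (F i) x (Pi.single i 1))
      - (1 / 2 : ℝ) * ((∑ i, fderiv ℝ (fun y => u y i) x (Pi.single i 1)) * ∑ j, w x j ^ 2)
      - r x * (∑ i, fderiv ℝ (fun y => w y i) x (Pi.single i 1)) * g x
      - (∑ i, fderiv ℝ r x (Pi.single i 1) * w x i) * g x := by
    intro x
    simp only [hdF, Finset.sum_add_distrib, ← Finset.mul_sum, ← Finset.sum_mul]
    ring
  rw [integral_congr_ae (Filter.Eventually.of_forall key),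
    integral_sub (by exact (iS.sub (iB.const_mul _)).sub iC) iD,
    integral_sub (by exact iS.sub (iB.const_mul _)) iC,
    integral_sub iS (iB.const_mul _), h0, integral_const_mul]
  ring
end
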